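/- Let D be the Desargues graph, i.e., the generalized Petersen graph GP(10,3): the graph on vertices u_0, …, u_9, v_0, …, v_9 with edges u_i u_{i+1 mod 10} (outer cycle), v_i v_{i+3 mod 10} (inner edges), and u_i v_i (spokes) for 0 ≤ i ≤ 9. Then there exists a real symmetric matrix A ∈ S(D) having exactly 6 positive eigenvalues, exactly 6 negative eigenvalues, and nullity 8; in particular (6,6) belongs to the inertia set of D. -/

import Mathlib

/-- The Desargues graph, i.e. the generalized Petersen graph `GP(10,3)`: outer
vertices `inl i` form a `10`-cycle, inner vertices `inr i` are joined by edges
`inr i — inr (i+3)`, and spokes join `inl i` to `inr i`. -/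
def desarguesGraph : SimpleGraph (Fin 10 ⊕ Fin 10) :=
  SimpleGraph.fromRel (fun a b =>
    match a, b with
    | Sum.inl i, Sum.inl j => j = i + 1
    | Sum.inr i, Sum.inr j => j = i + 3
    | Sum.inl i, Sum.inr j => i = j
    | Sum.inr _, Sum.inl _ => False)

/-- The number of positive eigenvalues (with multiplicity) of a real symmetric
(Hermitian) matrix. -/
noncomputable def posEigCount {n : Type*} [Fintype n] [DecidableEq n]
    {A : Matrix n n ℝ} (hA : A.IsHermitian) : ℕ :=
  Fintype.card {i // 0 < hA.eigenvalues i}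

/-- The number of negative eigenvalues (with multiplicity) of a real symmetric
(Hermitian) matrix. -/
noncomputable def negEigCount {n : Type*} [Fintype n] [DecidableEq n]
    {A : Matrix n n ℝ} (hA : A.IsHermitian) : ℕ :=
  Fintype.card {i // hA.eigenvalues i < 0}

/-- Signs of the outer edges `inl i — inl (i+1)`. -/
def dOuter : Fin 10 → ℤ := ![1, -1, 1, 1, -1, 1, 1, 1, 1, 1]
/-- Signs of the inner edges `inr i — inr (i+3)`. -/
def dInner : Fin 10 → ℤ := ![-1, 1, 1, -1, -1, 1, 1, 1, 1, -1]
/-- Signs of the spokes. -/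
def dSpoke : Fin 10 → ℤ := ![1, 1, 1, -1, 1, 1, 1, -1, -1, -1]

/-- The signed adjacency matrix: the Desargues graph is the incidence graph of edges and triangles
of the 4-simplex, and the signs are those of the simplicial coboundary. -/
def dMat : Matrix (Fin 10 ⊕ Fin 10) (Fin 10 ⊕ Fin 10) ℤ := fun a b =>
  match a, b with
  | Sum.inl i, Sum.inl j => if j = i + 1 then dOuter i else if i = j + 1 then dOuter j else 0
  | Sum.inr i, Sum.inr j => if j = i + 3 then dInner i else if i = j + 3 then dInner j else 0
  | Sum.inl i, Sum.inr j => if i = j then dSpoke i else 0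
  | Sum.inr i, Sum.inl j => if i = j then dSpoke i else 0

lemma dMat_cube : dMat * (dMat * dMat) = (5 : ℤ) • dMat := by
  have h : ∀ i j, (dMat * (dMat * dMat)) i j = 5 * dMat i j := by decide +kernel
  ext i j
  simpa using h i j

lemma dMat_trace : dMat.trace = 0 := by decide +kernel

lemma dMat_sq_trace : (dMat * dMat).trace = 60 := by decide +kernel

lemma dMat_symm : ∀ i j, dMat j i = dMat i j := by
  rintro (i | i) (j | j) <;> revert i j <;> decide +kernel

lemma dMat_adj : ∀ i j, i ≠ j → (dMat i j ≠ 0 ↔ desarguesGraph.Adj i j) := by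
  unfold desarguesGraph
  simp only [SimpleGraph.fromRel_adj]
  rintro (i | i) (j | j) <;> revert i j <;> decide +kernel

/-- The real version. -/
noncomputable def rMat : Matrix (Fin 10 ⊕ Fin 10) (Fin 10 ⊕ Fin 10) ℝ :=
  dMat.map (Int.castRingHom ℝ)

lemma rMat_herm : rMat.IsHermitian := by
  ext i j
  simp [rMat, dMat_symm i j]

lemma rMat_cube : rMat * (rMat * rMat) = (5 : ℝ) • rMat := by
  have h := congrArg (fun M => M.map (Int.castRingHom ℝ)) dMat_cube
  simp only [Matrix.map_mul] at h
  unfold rMat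
  rw [h]
  ext i j
  rw [Matrix.map_apply, Matrix.smul_apply, Matrix.smul_apply, Matrix.map_apply]
  simp only [smul_eq_mul, map_mul]
  simp

lemma rMat_trace : rMat.trace = 0 := by
  have h := congrArg (Int.castRingHom ℝ) dMat_trace
  rw [AddMonoidHom.map_trace] at h
  simpa [rMat] using h

lemma rMat_sq_trace : (rMat * rMat).trace = 60 := by
  have h := congrArg (Int.castRingHom ℝ) dMat_sq_trace
  rw [AddMonoidHom.map_trace] at h
  unfold rMat
  rw [← Matrix.map_mul]
  simpa using h

lemma trace_sq_eq {n : Type*} [Fintype n] [DecidableEq n] {A : Matrix n n ℝ}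
    (hA : A.IsHermitian) : (A * A).trace = ∑ i, hA.eigenvalues i ^ 2 := by
  conv_lhs => rw [hA.spectral_theorem, ← map_mul, Unitary.conjStarAlgAut_apply,
    Matrix.trace_mul_cycle, Unitary.coe_star_mul_self, one_mul, Matrix.diagonal_mul_diagonal,
    Matrix.trace_diagonal]
  simp [pow_two]

lemma eig_cube (i) : rMat_herm.eigenvalues i ^ 3 = 5 * rMat_herm.eigenvalues i := by
  have h1 := rMat_herm.mulVec_eigenvectorBasis i
  set v : Fin 10 ⊕ Fin 10 → ℝ := ⇑(rMat_herm.eigenvectorBasis i) with hv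
  have h2 := congrArg (fun M => Matrix.mulVec M v) rMat_cube
  simp only [← Matrix.mulVec_mulVec, Matrix.smul_mulVec, h1, Matrix.mulVec_smul, smul_smul] at h2
  have hv0 : v ≠ 0 := by
    intro h0
    apply rMat_herm.eigenvectorBasis.toBasis.ne_zero i
    ext k
    simpa using congrFun h0 k
  have h3 := smul_left_injective ℝ hv0 h2
  linear_combination h3

/-- There is a real symmetric matrix in `S(D)` for the Desargues graph `D` with
exactly `6` positive eigenvalues, exactly `6` negative eigenvalues, and nullity `8`;
in particular `(6,6)` belongs to the inertia set of `D`. -/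
theorem desargues_inertia_six_six :
    ∃ A : Matrix (Fin 10 ⊕ Fin 10) (Fin 10 ⊕ Fin 10) ℝ, ∃ hA : A.IsHermitian,
      (∀ i j : Fin 10 ⊕ Fin 10, i ≠ j → (A i j ≠ 0 ↔ desarguesGraph.Adj i j)) ∧
      posEigCount hA = 6 ∧ negEigCount hA = 6 ∧
      Module.finrank ℝ (LinearMap.ker A.mulVecLin) = 8 := by
  classical
  have hc := eig_cube
  have h0 : ∑ i, rMat_herm.eigenvalues i = 0 := by
    have := rMat_herm.trace_eq_sum_eigenvalues
    rw [rMat_trace] at this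
    simpa using this.symm
  have h2 : ∑ i, rMat_herm.eigenvalues i ^ 2 = 60 := by
    rw [← trace_sq_eq, rMat_sq_trace]
  have h5 : (0 : ℝ) < √5 := by positivity
  have hs : √5 * √5 = 5 := Real.mul_self_sqrt (by norm_num)
  have hcase : ∀ i, rMat_herm.eigenvalues i = 0 ∨ rMat_herm.eigenvalues i = √5 ∨
      rMat_herm.eigenvalues i = -√5 := by
    intro i
    have h : rMat_herm.eigenvalues i * ((rMat_herm.eigenvalues i - √5) *
        (rMat_herm.eigenvalues i + √5)) = 0 := by
      linear_combination hc i - rMat_herm.eigenvalues i * hs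
    rcases mul_eq_zero.1 h with h | h
    · exact Or.inl h
    rcases mul_eq_zero.1 h with h | h
    · exact Or.inr (Or.inl (by linarith))
    · exact Or.inr (Or.inr (by linarith))
  have e1 : ∀ i, rMat_herm.eigenvalues i = √5 * ((if 0 < rMat_herm.eigenvalues i then 1 else 0)
      - (if rMat_herm.eigenvalues i < 0 then 1 else 0)) := by
    intro i
    rcases hcase i with h | h | h <;> simp [h, h5, h5.le, h5.not_gt]
  have e2 : ∀ i, rMat_herm.eigenvalues i ^ 2 = 5 * ((if 0 < rMat_herm.eigenvalues i then 1 else 0)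
      + (if rMat_herm.eigenvalues i < 0 then 1 else 0)) := by
    intro i
    rcases hcase i with h | h | h <;> simp [h, h5, h5.le, h5.not_gt]
  rw [Finset.sum_congr rfl (fun i _ => e1 i), ← Finset.mul_sum, Finset.sum_sub_distrib] at h0
  rw [Finset.sum_congr rfl (fun i _ => e2 i), ← Finset.mul_sum, Finset.sum_add_distrib] at h2
  simp only [Finset.sum_boole] at h0 h2
  have hd := (mul_eq_zero.1 h0).resolve_left h5.ne'
  have hp : posEigCount rMat_herm = 6 := by
    unfold posEigCount
    rw [Fintype.card_subtype]
    have : ((Finset.univ.filter fun i => 0 < rMat_herm.eigenvalues i).card : ℝ) = 6 := by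
      linarith
    exact_mod_cast this
  have hn : negEigCount rMat_herm = 6 := by
    unfold negEigCount
    rw [Fintype.card_subtype]
    have : ((Finset.univ.filter fun i => rMat_herm.eigenvalues i < 0).card : ℝ) = 6 := by
      linarith
    exact_mod_cast this
  refine ⟨rMat, rMat_herm, ?_, hp, hn, ?_⟩
  · intro i j hij
    rw [← dMat_adj i j hij]
    simp [rMat]
  · have hr : rMat.rank = 12 := by
      rw [rMat_herm.rank_eq_card_non_zero_eigs]
      have hdisj : Disjoint (fun i => 0 < rMat_herm.eigenvalues i)
          (fun i => rMat_herm.eigenvalues i < 0) := by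
        rw [Pi.disjoint_iff]
        intro i
        rw [Prop.disjoint_iff]
        rintro ⟨ha, hb⟩
        exact lt_asymm ha hb
      have := Fintype.card_subtype_or_disjoint _ _ hdisj
      unfold posEigCount at hp
      unfold negEigCount at hn
      rw [hp, hn] at this
      refine Eq.trans ?_ this
      apply Fintype.card_congr
      apply Equiv.subtypeEquivRight
      intro i
      rw [ne_iff_lt_or_gt, or_comm]
    have := LinearMap.finrank_range_add_finrank_ker rMat.mulVecLin
    unfold Matrix.rank at hr
    rw [hr] at this
    simp at this
    omega
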